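/- Let C be the weighted cycle on 8 vertices v_0, v_1, ..., v_7 (in cyclic order) in which the edge v_0v_7 has resistance r with 0 < r < 1 and every other edge has resistance 1. Then the sum of effective resistances from v_1 to all vertices of C minus the sum of effective resistances from v_2 to all vertices of C equals (4r − 4)/(r + 7); in particular, Σ_{k ∈ V(C)} r_C(v_1, k) < Σ_{k ∈ V(C)} r_C(v_2, k). -/

import Mathlib

/-!  Common definitions: Moore–Penrose pseudoinverse, resistance distance and
Kirchhoff index of a simple graph (unit resistors), weighted electrical networks
(given by a symmetric conductance function), multigraph electrical networks,
and the octagonal chains `O(w)`.  -/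

/-- `M` is a Moore–Penrose pseudoinverse of `A`. -/
def Matrix.IsMoorePenroseInv {n : Type} [Fintype n] (A M : Matrix n n ℝ) : Prop :=
  A * M * A = A ∧ M * A * M = M ∧ (A * M).transpose = A * M ∧ (M * A).transpose = M * A

open Classical in
/-- The Moore–Penrose pseudoinverse of a real square matrix (it exists and is
unique; defined by choice). -/
noncomputable def mpinv {n : Type} [Fintype n] (A : Matrix n n ℝ) : Matrix n n ℝ :=
  if h : ∃ M, A.IsMoorePenroseInv M then h.choose else 0

open Classical in
/-- The (real) Laplacian matrix of a simple graph: degree diagonal minus adjacency. -/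
noncomputable def glap {V : Type} [Fintype V] (G : SimpleGraph V) : Matrix V V ℝ :=
  fun u v =>
    if u = v then ((Finset.univ.filter (fun t => G.Adj u t)).card : ℝ)
    else if G.Adj u v then -1 else 0

/-- Resistance distance `r_G(u,v) = (e_u - e_v)ᵀ L⁺ (e_u - e_v)` in a simple graph,
each edge being a unit resistor. -/
noncomputable def resDist {V : Type} [Fintype V] (G : SimpleGraph V) (u v : V) : ℝ :=
  mpinv (glap G) u u - mpinv (glap G) u v - mpinv (glap G) v u + mpinv (glap G) v v

/-- `r_G(a)`: the sum of the resistance distances between `a` and all other vertices. -/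
noncomputable def resSum {V : Type} [Fintype V] [DecidableEq V] (G : SimpleGraph V) (a : V) : ℝ :=
  ∑ b ∈ Finset.univ.erase a, resDist G a b

/-- The Kirchhoff index: the sum of resistance distances over all unordered pairs. -/
noncomputable def kirchhoff {V : Type} [Fintype V] (G : SimpleGraph V) : ℝ :=
  (∑ u, ∑ v, resDist G u v) / 2

/-- A weighted graph (electrical network) on `V`, recorded by its symmetric
conductance function: `cond u v` is the reciprocal of the resistance of the edge
`uv` (and `0` if there is no such edge). -/
structure Network (V : Type) where
  cond : V → V → ℝ
  symm : ∀ u v, cond u v = cond v u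
  nonneg : ∀ u v, 0 ≤ cond u v
  loopless : ∀ v, cond v v = 0

/-- The weighted Laplacian of a network. -/
noncomputable def Network.lap {V : Type} [Fintype V] [DecidableEq V] (N : Network V) :
    Matrix V V ℝ :=
  fun u v => if u = v then ∑ t, N.cond u t else -N.cond u v

/-- Effective resistance in a network, via the pseudoinverse of the weighted Laplacian. -/
noncomputable def Network.effRes {V : Type} [Fintype V] [DecidableEq V] (N : Network V)
    (u v : V) : ℝ :=
  mpinv N.lap u u - mpinv N.lap u v - mpinv N.lap v u + mpinv N.lap v v

/-- The underlying simple graph of a network. -/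
def Network.toGraph {V : Type} (N : Network V) : SimpleGraph V :=
  SimpleGraph.fromRel (fun u v => N.cond u v ≠ 0)

/-- An electrical network with multiple edges allowed: a finite edge type, each edge a
non-loop with two endpoints and a positive resistance. -/
structure MultiNetwork (V : Type) where
  E : Type
  [fE : Fintype E]
  ends : E → Sym2 V
  not_loop : ∀ e, ¬ (ends e).IsDiag
  res : E → ℝ
  res_pos : ∀ e, 0 < res e

attribute [instance] MultiNetwork.fE

/-- Total conductance between `u` and `v`: the sum, over all edges joining `u` and `v`,
of the reciprocals of their resistances. -/
noncomputable def MultiNetwork.cond {V : Type} [DecidableEq V] (M : MultiNetwork V)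
    (u v : V) : ℝ :=
  ∑ e ∈ Finset.univ.filter (fun e => M.ends e = s(u, v)), (M.res e)⁻¹

/-- The weighted Laplacian of a multigraph network. -/
noncomputable def MultiNetwork.lap {V : Type} [Fintype V] [DecidableEq V]
    (M : MultiNetwork V) : Matrix V V ℝ :=
  fun u v => if u = v then ∑ t, M.cond u t else -M.cond u v

/-- Effective resistance in a multigraph network. -/
noncomputable def MultiNetwork.effRes {V : Type} [Fintype V] [DecidableEq V]
    (M : MultiNetwork V) (u v : V) : ℝ :=
  mpinv M.lap u u - mpinv M.lap u v - mpinv M.lap v u + mpinv M.lap v v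

/-- The underlying simple graph of a multigraph network. -/
def MultiNetwork.toGraph {V : Type} (M : MultiNetwork V) : SimpleGraph V :=
  SimpleGraph.fromRel (fun u v => ∃ e, M.ends e = s(u, v))

/-!  The octagonal chain `O(w)` with `n` octagons, `w = (w_1, …, w_{n-2})`,
`w_i ∈ {0,1,2,3,4}`.  Its `6n+2` vertices are laid out along the outer boundary
cycle `0, 1, …, 6n+1`: position `0` is the top-left corner, the top boundary runs
rightwards (the top of the octagon `H_i`, `1 ≤ i ≤ n-2`, carries `w_i` inserted
vertices), then the right vertical edge, then the bottom boundary runs leftwards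
back to the bottom-left corner `6n+1`.  The graph is this outer cycle together
with the `n-1` chords `t_k b_k` shared by consecutive octagons. -/

/-- Boundary position of the top vertex `t_k` (`1 ≤ k ≤ n-1`) of the `k`-th shared
vertical edge: `t_k = k + w_1 + ⋯ + w_{k-1}`. -/
def tpos (n : ℕ) (w : Fin (n - 2) → Fin 5) (k : ℕ) : ℕ :=
  k + ∑ j ∈ Finset.univ.filter (fun j : Fin (n - 2) => (j : ℕ) + 1 < k), ((w j : ℕ))

/-- Boundary position of the bottom vertex `b_k` (`1 ≤ k ≤ n-1`) of the `k`-th shared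
vertical edge: `b_k = n + (w_1 + ⋯ + w_{n-2}) + 6 + Σ_{j ≥ k} (5 - w_j)`. -/
def bpos (n : ℕ) (w : Fin (n - 2) → Fin 5) (k : ℕ) : ℕ :=
  n + (∑ j, ((w j : ℕ))) + 6 +
    ∑ j ∈ Finset.univ.filter (fun j : Fin (n - 2) => k ≤ (j : ℕ) + 1), (5 - ((w j : ℕ)))

/-- The octagonal chain `O(w)` with `n` octagons: the outer boundary cycle on
`6n+2` vertices together with the chords `t_k b_k`, `k = 1, …, n-1`. -/
def octChain (n : ℕ) (w : Fin (n - 2) → Fin 5) : SimpleGraph (Fin (6 * n + 2)) :=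
  SimpleGraph.fromRel (fun a b =>
    ((a : ℕ) + 1 = (b : ℕ)) ∨ ((a : ℕ) = 6 * n + 1 ∧ (b : ℕ) = 0) ∨
    ∃ k, 1 ≤ k ∧ k ≤ n - 1 ∧ (a : ℕ) = tpos n w k ∧ (b : ℕ) = bpos n w k)

theorem exists_mp_aux {n : Type} [Fintype n] [DecidableEq n] (A : Matrix n n ℝ)
    (hA : A.IsHermitian) : ∃ M, A.IsMoorePenroseInv M := by
  let U : Matrix n n ℝ := (hA.eigenvectorUnitary : Matrix n n ℝ)
  let d := hA.eigenvalues
  have hU : U.transpose * U = 1 := by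
    have h := Unitary.coe_star_mul_self hA.eigenvectorUnitary
    rw [Matrix.star_eq_conjTranspose, Matrix.conjTranspose_eq_transpose_of_trivial] at h
    exact h
  have hS : A = U * Matrix.diagonal d * U.transpose := by
    have h := hA.spectral_theorem
    rw [Unitary.conjStarAlgAut_apply, Matrix.star_eq_conjTranspose,
      Matrix.conjTranspose_eq_transpose_of_trivial] at h
    exact h
  have key : ∀ e f : n → ℝ, (U * Matrix.diagonal e * U.transpose) *
      (U * Matrix.diagonal f * U.transpose)
      = U * Matrix.diagonal (fun i => e i * f i) * U.transpose := by
    intro e f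
    calc _ = U * Matrix.diagonal e * (U.transpose * U) * Matrix.diagonal f * U.transpose := by
          simp only [Matrix.mul_assoc]
      _ = _ := by rw [hU, Matrix.mul_one, Matrix.mul_assoc U, Matrix.diagonal_mul_diagonal]
  have keyT : ∀ e : n → ℝ, (U * Matrix.diagonal e * U.transpose).transpose
      = U * Matrix.diagonal e * U.transpose := by
    intro e
    simp [Matrix.transpose_mul, Matrix.mul_assoc]
  refine ⟨U * Matrix.diagonal (fun i => (d i)⁻¹) * U.transpose, ?_, ?_, ?_, ?_⟩
  · rw [hS, key, key]
    simp only [mul_inv_mul_cancel]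
  · rw [hS, key, key]
    congr 3
    funext i
    by_cases h : d i = 0
    · simp [h]
    · field_simp
  · rw [hS, key, keyT]
  · rw [hS, key, keyT]

theorem lap_transpose_aux (N : Network (Fin 8)) : N.lap.transpose = N.lap := by
  ext i j
  simp only [Matrix.transpose_apply, Network.lap]
  by_cases h : i = j
  · subst h; rfl
  · rw [if_neg h, if_neg (Ne.symm h), N.symm]

theorem effRes_aux (N : Network (Fin 8)) (u v : Fin 8) (x : Fin 8 → ℝ)
    (hx : N.lap.mulVec x = Pi.single u 1 - Pi.single v 1) : N.effRes u v = x u - x v := by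
  have hex : ∃ M, N.lap.IsMoorePenroseInv M := by
    apply exists_mp_aux
    rw [Matrix.IsHermitian, Matrix.conjTranspose_eq_transpose_of_trivial, lap_transpose_aux]
  have hM : N.lap.IsMoorePenroseInv (mpinv N.lap) := by
    rw [mpinv, dif_pos hex]; exact hex.choose_spec
  have h1 : N.effRes u v = (Pi.single u 1 - Pi.single v 1 : Fin 8 → ℝ) ⬝ᵥ
      (mpinv N.lap).mulVec (Pi.single u 1 - Pi.single v 1) := by
    simp [Network.effRes, Matrix.mulVec_sub, sub_dotProduct]
    ring
  have h2 : Matrix.vecMul x N.lap = Pi.single u 1 - Pi.single v 1 := by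
    rw [← hx, ← Matrix.mulVec_transpose, lap_transpose_aux]
  have h3 : (Pi.single u 1 - Pi.single v 1 : Fin 8 → ℝ) ⬝ᵥ
      (mpinv N.lap).mulVec (Pi.single u 1 - Pi.single v 1) = x ⬝ᵥ N.lap.mulVec x := by
    conv_lhs => rw [← hx]
    conv_lhs => rw [hx, ← h2, ← Matrix.dotProduct_mulVec, h2, ← hx]
    rw [Matrix.mulVec_mulVec, Matrix.mulVec_mulVec, hM.1]
  rw [h1, h3, hx]
  simp [dotProduct_sub]

theorem lap_mulVec_aux (N : Network (Fin 8)) (x : Fin 8 → ℝ) (i : Fin 8) :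
    N.lap.mulVec x i = ∑ k, N.cond i k * (x i - x k) := by
  have h : ∀ k, N.lap i k = (if i = k then ∑ t, N.cond i t else 0) - N.cond i k := by
    intro k
    by_cases h : i = k
    · subst h; simp [Network.lap, N.loopless]
    · simp [Network.lap, h]
  simp only [Matrix.mulVec, dotProduct, h, sub_mul, mul_sub, Finset.sum_sub_distrib, ite_mul,
    zero_mul, Finset.sum_ite_eq, Finset.mem_univ, if_true, Finset.sum_mul]

/-- candidate resistances -/
noncomputable def Raux (r : ℝ) (i j : Fin 8) : ℝ :=
  |((i : ℕ) : ℝ) - ((j : ℕ) : ℝ)| * (7 + r - |((i : ℕ) : ℝ) - ((j : ℕ) : ℝ)|) / (7 + r)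

set_option maxHeartbeats 4000000 in
theorem weighted_octagon_resSum_difference (r : ℝ) (hr0 : 0 < r) (hr1 : r < 1)
    (N : Network (Fin 8))
    (hcyc : ∀ a b : Fin 8, (a : ℕ) + 1 = (b : ℕ) → N.cond a b = 1)
    (hchord : N.cond 0 7 = r⁻¹)
    (hnon : ∀ a b : Fin 8, a ≠ b → (a : ℕ) + 1 ≠ (b : ℕ) → (b : ℕ) + 1 ≠ (a : ℕ) →
      ¬((a : ℕ) = 0 ∧ (b : ℕ) = 7) → ¬((a : ℕ) = 7 ∧ (b : ℕ) = 0) → N.cond a b = 0) :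
    (∑ k, N.effRes 1 k) - (∑ k, N.effRes 2 k) = (4 * r - 4) / (r + 7) ∧
      (∑ k, N.effRes 1 k) < (∑ k, N.effRes 2 k) := by
  have h7 : (7 + r) ≠ 0 := by positivity
  have hr : r ≠ 0 := hr0.ne'
  have hc : ∀ i k : Fin 8, N.cond i k = if (i : ℕ) + 1 = (k : ℕ) ∨ (k : ℕ) + 1 = (i : ℕ) then 1
      else if ((i : ℕ) = 0 ∧ (k : ℕ) = 7) ∨ ((i : ℕ) = 7 ∧ (k : ℕ) = 0) then r⁻¹ else 0 := by
    intro i k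
    split_ifs with h1 h2
    · rcases h1 with h | h
      · exact hcyc _ _ h
      · rw [N.symm]; exact hcyc _ _ h
    · rcases h2 with ⟨h, h'⟩ | ⟨h, h'⟩
      · rw [show i = 0 from Fin.ext h, show k = 7 from Fin.ext h', hchord]
      · rw [show i = 7 from Fin.ext h, show k = 0 from Fin.ext h', N.symm, hchord]
    · by_cases h : i = k
      · rw [h, N.loopless]
      · push Not at h1 h2
        exact hnon i k h h1.1 h1.2 (fun h => h2.1 h.1 h.2) (fun h => h2.2 h.1 h.2)
  have hLR : ∀ i j : Fin 8, ∑ k, N.cond i k * (Raux r i j - Raux r k j)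
      = (if i = 0 ∨ i = 7 then (r + 1) / (7 + r) else 2 / (7 + r))
        - 2 * (if i = j then 1 else 0) := by
    intro i j
    simp only [hc, Fin.sum_univ_eight]
    fin_cases i <;> fin_cases j <;> simp [Raux] <;> norm_num [abs_of_nonneg, abs_of_neg] <;> field_simp <;> ring
  have hE : ∀ u v, N.effRes u v = Raux r u v := by
    intro u v
    rw [effRes_aux N u v (fun k => -(Raux r k u - Raux r k v) / 2)]
    · have : Raux r v u = Raux r u v := by simp only [Raux, abs_sub_comm]
      simp only [this]
      simp [Raux]
      ring
    · funext i
      rw [lap_mulVec_aux]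
      have : ∀ k, N.cond i k * (-(Raux r i u - Raux r i v) / 2 - -(Raux r k u - Raux r k v) / 2)
        = -(1/2) * (N.cond i k * (Raux r i u - Raux r k u))
          + (1/2) * (N.cond i k * (Raux r i v - Raux r k v)) := by intro k; ring
      simp only [this, Finset.sum_add_distrib, ← Finset.mul_sum, hLR, Pi.sub_apply,
        Pi.single_apply]
      ring
  have hmain : (∑ k, N.effRes 1 k) - (∑ k, N.effRes 2 k) = (4 * r - 4) / (r + 7) := by
    simp only [hE, Fin.sum_univ_eight]
    rw [add_comm r 7]
    simp [Raux]
    norm_num [abs_of_nonneg, abs_of_neg]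
    field_simp
    ring
  refine ⟨hmain, ?_⟩
  have : (4 * r - 4) / (r + 7) < 0 := div_neg_of_neg_of_pos (by linarith) (by linarith)
  linarith
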